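/- Let (R, m) be a complete local ring of the form R = k[[x_1,…,x_n]]/(x_1⋯x_r) over a field k, with 1 ≤ r ≤ n, and let I_D = (x_1⋯x̂_i⋯x_r : 1 ≤ i ≤ r) be the ideal of the singular locus. Then the R/I_D-module (x_1)/(x_1)I_D is free of rank one, generated by the class of x_1. -/

import Mathlib

noncomputable section

universe u

variable (k : Type u) [Field k] (n r : ℕ)

/-- The complete local ring `R = k[[x₁,…,xₙ]]/(x₁⋯x_r)` of a normal crossing
singularity. -/
abbrev NCComplete : Type u :=
  MvPowerSeries (Fin n) k ⧸
    (Ideal.span {∏ i ∈ Finset.univ.filter (fun i : Fin n => (i : ℕ) < r),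
      MvPowerSeries.X i} : Ideal (MvPowerSeries (Fin n) k))

/-- The ideal `I_D = (x₁⋯x̂ⱼ⋯x_r : 1 ≤ j ≤ r)` of the singular locus of
`Spec k[[x]]/(x₁⋯x_r)`. -/
def singIdeal : Ideal (NCComplete k n r) :=
  Ideal.span ((fun j : Fin n =>
    Ideal.Quotient.mk _ (∏ i ∈ Finset.univ.filter
      (fun i : Fin n => (i : ℕ) < r ∧ i ≠ j), MvPowerSeries.X i)) ''
        {j : Fin n | (j : ℕ) < r})

/-- The annihilator of `x̄ⱼ`, for a component `j`, is contained in the ideal of the singular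
locus. -/
theorem mem_singIdeal_of_mul_X_eq_zero {j : Fin n} (hj : (j : ℕ) < r) {a : NCComplete k n r}
    (ha : a * Ideal.Quotient.mk _ (MvPowerSeries.X j) = 0) : a ∈ singIdeal k n r := by
  obtain ⟨c, rfl⟩ := Ideal.Quotient.mk_surjective a
  rw [← map_mul, Ideal.Quotient.eq_zero_iff_mem, Ideal.mem_span_singleton] at ha
  obtain ⟨d, hd⟩ := ha
  have hprod : ∏ i ∈ Finset.univ.filter (fun i : Fin n => (i : ℕ) < r),
      (MvPowerSeries.X i : MvPowerSeries (Fin n) k) =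
      MvPowerSeries.X j * ∏ i ∈ Finset.univ.filter (fun i : Fin n => (i : ℕ) < r ∧ i ≠ j),
        MvPowerSeries.X i := by
    rw [← Finset.mul_prod_erase _ _ (Finset.mem_filter.2 ⟨Finset.mem_univ j, hj⟩)]
    congr 2
    ext i
    simp [and_comm]
  have hc : c = (∏ i ∈ Finset.univ.filter (fun i : Fin n => (i : ℕ) < r ∧ i ≠ j),
      MvPowerSeries.X i) * d := by
    rw [hprod, mul_assoc, mul_comm c] at hd
    have hX : (MvPowerSeries.X j : MvPowerSeries (Fin n) k) ∈
        nonZeroDivisors (MvPowerSeries (Fin n) k) := MvPowerSeries.X_mem_nonzeroDivisors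
    exact (mul_cancel_left_mem_nonZeroDivisors hX).1 hd
  rw [hc, map_mul]
  exact Ideal.mul_mem_right _ _ (Ideal.subset_span ⟨j, hj, rfl⟩)

/-- Let `R = k[[x₁,…,xₙ]]/(x₁⋯x_r)` with `1 ≤ r ≤ n` and let
`I_D = (x₁⋯x̂ᵢ⋯x_r : 1 ≤ i ≤ r)` be the ideal of the singular locus.  Then the
`R/I_D`-module `(x₁)/(x₁)·I_D` is free of rank one, generated by the class of `x₁`:
the map `a ↦ a·x̄₁` is surjective onto `(x₁)/(x₁)I_D` and its kernel is exactly
`I_D`. -/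
theorem conormal_free_rank_one (hr : 0 < r) (hrn : r ≤ n) :
    letI x₁ : NCComplete k n r :=
      Ideal.Quotient.mk _ (MvPowerSeries.X (⟨0, lt_of_lt_of_le hr hrn⟩ : Fin n))
    letI N : Ideal (NCComplete k n r) := Ideal.span {x₁}
    letI M := ↥N ⧸ Submodule.comap N.subtype (singIdeal k n r • N)
    letI x₁bar : M := Submodule.Quotient.mk ⟨x₁, Ideal.subset_span rfl⟩
    Function.Surjective (fun a : NCComplete k n r => a • x₁bar) ∧
      ∀ a : NCComplete k n r, a • x₁bar = 0 ↔ a ∈ singIdeal k n r := by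
  constructor
  · intro m
    obtain ⟨⟨y, hy⟩, rfl⟩ := Submodule.Quotient.mk_surjective _ m
    obtain ⟨a, rfl⟩ := Ideal.mem_span_singleton'.1 hy
    exact ⟨a, rfl⟩
  · intro a
    rw [← Submodule.Quotient.mk_smul, Submodule.Quotient.mk_eq_zero, Submodule.mem_comap,
      map_smul, Submodule.subtype_apply, smul_eq_mul, smul_eq_mul, Ideal.mem_mul_span_singleton]
    constructor
    · rintro ⟨b, hb, hab⟩
      have hsub : a - b ∈ singIdeal k n r :=
        mem_singIdeal_of_mul_X_eq_zero k n r (j := ⟨0, lt_of_lt_of_le hr hrn⟩) hr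
          (by rw [sub_mul, hab, sub_self])
      simpa using add_mem hsub hb
    · exact fun ha => ⟨a, ha, rfl⟩
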